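/- arXiv:1707.00033 — 4 statements merged into one kernel-verified Lean document; each statement's English description precedes it below -/
import Mathlib

section
/- Let T > 0 and σ̄ > 0, and for each positive integer n set a_n := σ̄·√(T/n) and define z(n) := exp(−2a_n)·σ̄^{−2}·(exp(2a_n) + exp(−2a_n) − 2)/(2 + exp(a_n) + exp(−a_n)). Then there exists a constant C > 0 (depending only on σ̄ and T) such that for every positive integer n, |z(n) − T/n| ≤ C·n^{−3/2}. -/
/-- The increment factor in the estimate simplifies to `exp (-a) * (1 - exp (-a)) ^ 2`. -/
theorem exp_mul_div_eq (a : ℝ) :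
    Real.exp (-2 * a) * ((Real.exp (2 * a) + Real.exp (-2 * a) - 2) /
      (2 + Real.exp a + Real.exp (-a))) = Real.exp (-a) * (1 - Real.exp (-a)) ^ 2 := by
  have hE := Real.exp_pos a
  have h2 : Real.exp (2 * a) = Real.exp a ^ 2 := by rw [← Real.exp_nat_mul]; norm_num
  rw [neg_mul, Real.exp_neg, Real.exp_neg, h2]
  generalize Real.exp a = E at *
  have hne : 2 + E + E⁻¹ ≠ 0 := by positivity
  rw [← mul_div_assoc, div_eq_iff hne]
  field_simp
  ring

theorem abs_exp_neg_mul_sub_sq_le {a : ℝ} (ha : 0 ≤ a) :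
    |Real.exp (-a) * (1 - Real.exp (-a)) ^ 2 - a ^ 2| ≤ 3 * a ^ 3 := by
  have hu := Real.exp_pos (-a)
  have hu1 : Real.exp (-a) ≤ 1 := Real.exp_le_one_iff.2 (by linarith)
  have hlow : 1 - Real.exp (-a) ≤ a := by linarith [Real.add_one_le_exp (-a)]
  have hau : a * Real.exp (-a) ≤ 1 - Real.exp (-a) := by
    have h : Real.exp a * Real.exp (-a) = 1 := by rw [← Real.exp_add]; simp
    nlinarith [Real.add_one_le_exp a]
  have hcube : 1 - 3 * a ≤ Real.exp (-a) ^ 3 := by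
    rw [← Real.exp_nat_mul]
    push_cast
    linarith [Real.add_one_le_exp (3 * -a)]
  generalize Real.exp (-a) = u at *
  have hupper : u * (1 - u) ^ 2 ≤ 1 * a ^ 2 := by gcongr
  have hlower : u * (a * u) ^ 2 ≤ u * (1 - u) ^ 2 := by gcongr
  have ha3 : 0 ≤ a ^ 3 := by positivity
  rw [abs_le]
  constructor
  · nlinarith [mul_le_mul_of_nonneg_left hcube (sq_nonneg a)]
  · linarith

/-- For `T > 0` and `σ̄ > 0`, setting `aₙ := σ̄·√(T/n)` and
`z(n) := exp(−2aₙ)·σ̄⁻²·(exp(2aₙ) + exp(−2aₙ) − 2)/(2 + exp(aₙ) + exp(−aₙ))`,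
there is a constant `C > 0` (depending only on `σ̄, T`) such that
`|z(n) − T/n| ≤ C·n^(−3/2)` for every positive integer `n`. -/
theorem stmt0 (T σbar : ℝ) (hT : 0 < T) (hσ : 0 < σbar) :
    ∃ C : ℝ, 0 < C ∧ ∀ n : ℕ, 0 < n →
      |Real.exp (-2 * (σbar * Real.sqrt (T / n))) / σbar ^ 2 *
          ((Real.exp (2 * (σbar * Real.sqrt (T / n))) +
              Real.exp (-2 * (σbar * Real.sqrt (T / n))) - 2) /
            (2 + Real.exp (σbar * Real.sqrt (T / n)) +
              Real.exp (-(σbar * Real.sqrt (T / n))))) - T / n|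
        ≤ C * (n : ℝ) ^ (-(3 : ℝ) / 2) := by
  refine ⟨3 * σbar * Real.sqrt T ^ 3, by positivity, fun n hn => ?_⟩
  have hn' : (0 : ℝ) < n := by exact_mod_cast hn
  have hpow : (n : ℝ) ^ (-(3 : ℝ) / 2) = (Real.sqrt n ^ 3)⁻¹ := by
    rw [Real.sqrt_eq_rpow, ← Real.rpow_mul_natCast hn'.le, ← Real.rpow_neg hn'.le]
    norm_num
  have hTn : T / n = (σbar * Real.sqrt (T / n)) ^ 2 / σbar ^ 2 := by
    rw [mul_pow, Real.sq_sqrt (by positivity)]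
    field_simp
  have hbound : 3 * σbar * Real.sqrt T ^ 3 * (n : ℝ) ^ (-(3 : ℝ) / 2) = 3 * (σbar * Real.sqrt (T / n)) ^ 3 / σbar ^ 2 := by
    rw [hpow, Real.sqrt_div hT.le]
    field_simp
  have ha : 0 ≤ σbar * Real.sqrt (T / n) := by positivity
  rw [hbound, div_mul_eq_mul_div, exp_mul_div_eq]
  conv_lhs => rw [show ∀ x : ℝ, x - T / n = x - (σbar * Real.sqrt (T / n)) ^ 2 / σbar ^ 2 from
    fun x => by rw [← hTn]]
  rw [← sub_div, abs_div, abs_of_pos (by positivity : 0 < σbar ^ 2)]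
  gcongr
  exact abs_exp_neg_mul_sub_sq_le ha
end

section
/- Let σ̄ > 0 and T > 0. There exists a constant C > 0 depending only on σ̄ and T such that for every positive integer n, every filtered probability space (Ω, F, (G_k)_{k=0}^n, P), every s > 0, and every strictly positive martingale (M_k)_{k=0}^n with respect to (G_k) satisfying M_0 = s a.s. and M_k / M_{k−1} ∈ { exp(−σ̄·√(T/n)), 1, exp(σ̄·√(T/n)) } a.s. for all k = 1, …, n, one has E[ max_{0 ≤ k ≤ n} M_k⁴ ] ≤ C·s⁴. -/
open MeasureTheory

section

variable {Ω : Type*} {mΩ : MeasurableSpace Ω} {μ : Measure Ω}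

theorem integrable_of_ae_mem_Icc [IsFiniteMeasure μ] {f : Ω → ℝ} {B : ℝ}
    (hf : AEStronglyMeasurable f μ) (h : ∀ᵐ ω ∂μ, 0 ≤ f ω ∧ f ω ≤ B) : Integrable f μ := by
  refine Integrable.of_bound hf B ?_
  filter_upwards [h] with ω hω
  rw [Real.norm_of_nonneg hω.1]
  exact hω.2

theorem integral_mul_sub_eq_zero_of_condExp [IsFiniteMeasure μ] {m : MeasurableSpace Ω}
    (hm : m ≤ mΩ) {X Y Z : Ω → ℝ} (hX : Integrable X μ) (hY : Integrable Y μ)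
    (hXY : μ[Y | m] =ᵐ[μ] X) (hZ : StronglyMeasurable[m] Z) {B : ℝ}
    (hZB : ∀ᵐ ω ∂μ, 0 ≤ Z ω ∧ Z ω ≤ B) :
    ∫ ω, Z ω * (Y ω - X ω) ∂μ = 0 := by
  have hb : ∀ᵐ ω ∂μ, ‖Z ω‖ ≤ B := by
    filter_upwards [hZB] with ω hω
    rw [Real.norm_of_nonneg hω.1]
    exact hω.2
  have hZ' := (hZ.mono hm).aestronglyMeasurable (μ := μ)
  have iZY : Integrable (Z * Y) μ := hY.bdd_mul hZ' hb
  have iZX : Integrable (Z * X) μ := hX.bdd_mul hZ' hb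
  have key : ∫ ω, (Z * Y) ω ∂μ = ∫ ω, (Z * X) ω ∂μ := by
    rw [← integral_condExp hm]
    refine integral_congr_ae ?_
    filter_upwards [condExp_mul_of_stronglyMeasurable_left hZ iZY hY, hXY] with ω h1 h2
    rw [h1, Pi.mul_apply, Pi.mul_apply, h2]
  calc ∫ ω, Z ω * (Y ω - X ω) ∂μ = ∫ ω, ((Z * Y) ω - (Z * X) ω) ∂μ := by
        simp only [Pi.mul_apply, mul_sub]
    _ = 0 := by rw [integral_sub iZY iZX, key, sub_self]

theorem four_mul_pow_three_mul_le {x m : ℝ} (hx : 0 ≤ x) (hm : 0 ≤ m) :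
    4 * m ^ 3 * x ≤ x ^ 4 + 3 * m ^ 4 := by
  nlinarith [mul_nonneg (sq_nonneg (x - m)) (by positivity : 0 ≤ x ^ 2 + 2 * x * m + 3 * m ^ 2)]

/-- The pathwise inequality behind Doob's `L⁴` maximal inequality. -/
theorem pow_four_sub_max_le {x x' m : ℝ} (hx' : 0 ≤ x') (hm : 0 ≤ m) :
    (m ⊔ x') ^ 4 - 4 / 3 * ((m ⊔ x') ^ 3 * x') ≤
      m ^ 4 - 4 / 3 * (m ^ 3 * x) - 4 / 3 * (m ^ 3 * (x' - x)) := by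
  rcases le_total x' m with h | h
  · rw [sup_eq_left.2 h]
    linarith
  · rw [sup_eq_right.2 h]
    linarith [four_mul_pow_three_mul_le hx' hm]

theorem stronglyMeasurable_partialSups {ℱ : Filtration ℕ mΩ} {M : ℕ → Ω → ℝ} {n : ℕ}
    (hM : ∀ k, k ≤ n → StronglyMeasurable[ℱ k] (M k)) :
    ∀ k, k ≤ n → StronglyMeasurable[ℱ k] (fun ω => partialSups (fun j => M j ω) k)
  | 0, h => by simpa using hM 0 h
  | k + 1, h => by
    simp only [partialSups_add_one]
    have hk := (stronglyMeasurable_partialSups hM k (by omega)).mono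
      (ℱ.mono (Nat.le_add_right k 1))
    exact @StronglyMeasurable.sup _ _ _ _ (ℱ (k + 1)) _ _ _ hk (hM (k + 1) h)

/-- Doob's `L⁴` maximal inequality for bounded nonnegative martingales on a finite horizon. -/
theorem integral_partialSups_pow_four_le [IsFiniteMeasure μ] {ℱ : Filtration ℕ mΩ}
    {M : ℕ → Ω → ℝ} {n : ℕ} {B : ℝ}
    (hM : ∀ k, k ≤ n → StronglyMeasurable[ℱ k] (M k))
    (hmart : ∀ k, k < n → μ[M (k + 1) | ℱ k] =ᵐ[μ] M k)
    (hB : ∀ᵐ ω ∂μ, ∀ k, k ≤ n → 0 ≤ M k ω ∧ M k ω ≤ B) :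
    Integrable (fun ω => partialSups (fun j => M j ω) n ^ 4) μ ∧
    ∫ ω, partialSups (fun j => M j ω) n ^ 4 ∂μ ≤ 16 / 3 * ∫ ω, M n ω ^ 4 ∂μ := by
  set S : ℕ → Ω → ℝ := fun k ω => partialSups (fun j => M j ω) k with hS
  have hSm := stronglyMeasurable_partialSups hM
  have hSB : ∀ᵐ ω ∂μ, ∀ k, k ≤ n → 0 ≤ S k ω ∧ S k ω ≤ B := by
    filter_upwards [hB] with ω hω k hk
    refine ⟨(hω 0 (Nat.zero_le n)).1.trans (le_partialSups_of_le (fun j => M j ω) (Nat.zero_le k)), ?_⟩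
    exact partialSups_le _ _ _ fun j hj => (hω j (hj.trans hk)).2
  have hMm' : ∀ k, k ≤ n → AEStronglyMeasurable (M k) μ := fun k hk =>
    ((hM k hk).mono (ℱ.le k)).aestronglyMeasurable
  have hSm' : ∀ k, k ≤ n → AEStronglyMeasurable (S k) μ := fun k hk =>
    ((hSm k hk).mono (ℱ.le k)).aestronglyMeasurable
  have iM : ∀ k, k ≤ n → Integrable (M k) μ := fun k hk =>
    integrable_of_ae_mem_Icc (hMm' k hk) (hB.mono fun ω hω => hω k hk)
  have hS3B : ∀ k, k ≤ n → ∀ᵐ ω ∂μ, 0 ≤ S k ω ^ 3 ∧ S k ω ^ 3 ≤ B ^ 3 := fun k hk =>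
    hSB.mono fun ω hω => ⟨pow_nonneg (hω k hk).1 3, pow_le_pow_left₀ (hω k hk).1 (hω k hk).2 3⟩
  have iS4 : ∀ k, k ≤ n → Integrable (fun ω => S k ω ^ 4) μ := fun k hk =>
    integrable_of_ae_mem_Icc ((hSm' k hk).pow 4) (hSB.mono fun ω hω =>
      ⟨pow_nonneg (hω k hk).1 4, pow_le_pow_left₀ (hω k hk).1 (hω k hk).2 4⟩)
  have iM4 : Integrable (fun ω => M n ω ^ 4) μ :=
    integrable_of_ae_mem_Icc ((hMm' n le_rfl).pow 4) (hB.mono fun ω hω =>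
      ⟨pow_nonneg (hω n le_rfl).1 4, pow_le_pow_left₀ (hω n le_rfl).1 (hω n le_rfl).2 4⟩)
  have iS3 : ∀ k, k ≤ n → ∀ f : Ω → ℝ, Integrable f μ →
      Integrable (fun ω => S k ω ^ 3 * f ω) μ := fun k hk f hf =>
    hf.bdd_mul ((hSm' k hk).pow 3) (c := B ^ 3) <| by
      filter_upwards [hS3B k hk] with ω hω
      rw [Real.norm_of_nonneg hω.1]
      exact hω.2
  have iφ : ∀ k, k ≤ n →
      Integrable (fun ω => S k ω ^ 4 - 4 / 3 * (S k ω ^ 3 * M k ω)) μ := fun k hk =>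
    (iS4 k hk).sub ((iS3 k hk _ (iM k hk)).const_mul _)
  have hφ : ∀ k, k ≤ n → ∫ ω, (S k ω ^ 4 - 4 / 3 * (S k ω ^ 3 * M k ω)) ∂μ ≤ 0 := by
    intro k
    induction k with
    | zero =>
      intro _
      refine integral_nonpos fun ω => ?_
      simp only [hS, partialSups_zero, Pi.zero_apply]
      nlinarith [sq_nonneg (M 0 ω ^ 2)]
    | succ k ih =>
      intro hk
      have hk' : k ≤ n := by omega
      have iD : Integrable (fun ω => S k ω ^ 3 * (M (k + 1) ω - M k ω)) μ :=
        iS3 k hk' _ ((iM (k + 1) hk).sub (iM k hk'))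
      have hD : ∫ ω, S k ω ^ 3 * (M (k + 1) ω - M k ω) ∂μ = 0 :=
        integral_mul_sub_eq_zero_of_condExp (ℱ.le k) (iM k hk') (iM (k + 1) hk)
          (hmart k hk) ((hSm k hk').pow 3) (hS3B k hk')
      calc ∫ ω, (S (k + 1) ω ^ 4 - 4 / 3 * (S (k + 1) ω ^ 3 * M (k + 1) ω)) ∂μ
          ≤ ∫ ω, ((S k ω ^ 4 - 4 / 3 * (S k ω ^ 3 * M k ω)) -
              4 / 3 * (S k ω ^ 3 * (M (k + 1) ω - M k ω))) ∂μ := by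
            refine integral_mono_ae (iφ (k + 1) hk)
              ((iφ k hk').sub (iD.const_mul _)) ?_
            filter_upwards [hB, hSB] with ω h1 h2
            simp only [hS, partialSups_add_one]
            exact pow_four_sub_max_le (h1 (k + 1) hk).1 (h2 k hk').1
        _ = ∫ ω, (S k ω ^ 4 - 4 / 3 * (S k ω ^ 3 * M k ω)) ∂μ := by
            rw [integral_sub (iφ k hk') (iD.const_mul _), integral_const_mul, hD, mul_zero, sub_zero]
        _ ≤ 0 := ih hk'
  refine ⟨iS4 n le_rfl, ?_⟩
  have hle : ∫ ω, (1 / 2 * S n ω ^ 4 - 8 / 3 * M n ω ^ 4) ∂μ ≤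
      ∫ ω, (S n ω ^ 4 - 4 / 3 * (S n ω ^ 3 * M n ω)) ∂μ := by
    refine integral_mono_ae (((iS4 n le_rfl).const_mul _).sub (iM4.const_mul _))
      (iφ n le_rfl) ?_
    filter_upwards [hB, hSB] with ω h1 h2
    have hx := (h1 n le_rfl).1
    have hm := (h2 n le_rfl).1
    have := mul_nonneg (sq_nonneg (S n ω - 2 * M n ω))
      (by positivity : 0 ≤ S n ω ^ 2 / 2 + 2 / 3 * (S n ω * M n ω) + 2 / 3 * M n ω ^ 2)
    linarith
  rw [integral_sub ((iS4 n le_rfl).const_mul _) (iM4.const_mul _), integral_const_mul,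
    integral_const_mul] at hle
  linarith [hφ n le_rfl]

/-- If the increments of a bounded nonnegative martingale satisfy a second-order bound on the
fourth power, then its fourth moment grows at most geometrically. -/
theorem integral_pow_four_le_geometric [IsFiniteMeasure μ] {ℱ : Filtration ℕ mΩ}
    {M : ℕ → Ω → ℝ} {n : ℕ} {B β : ℝ} (hβ : 0 ≤ β)
    (hM : ∀ k, k ≤ n → StronglyMeasurable[ℱ k] (M k))
    (hmart : ∀ k, k < n → μ[M (k + 1) | ℱ k] =ᵐ[μ] M k)
    (hB : ∀ᵐ ω ∂μ, ∀ k, k ≤ n → 0 ≤ M k ω ∧ M k ω ≤ B)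
    (hstep : ∀ᵐ ω ∂μ, ∀ k, k < n →
      M (k + 1) ω ^ 4 ≤ (1 + β) * M k ω ^ 4 + 4 * (M k ω ^ 3 * (M (k + 1) ω - M k ω))) :
    ∀ k, k ≤ n → ∫ ω, M k ω ^ 4 ∂μ ≤ (1 + β) ^ k * ∫ ω, M 0 ω ^ 4 ∂μ := by
  have hMm' : ∀ k, k ≤ n → AEStronglyMeasurable (M k) μ := fun k hk =>
    ((hM k hk).mono (ℱ.le k)).aestronglyMeasurable
  have iM : ∀ k, k ≤ n → Integrable (M k) μ := fun k hk =>
    integrable_of_ae_mem_Icc (hMm' k hk) (hB.mono fun ω hω => hω k hk)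
  have hpow : ∀ p k, k ≤ n → ∀ᵐ ω ∂μ, 0 ≤ M k ω ^ p ∧ M k ω ^ p ≤ B ^ p := fun p k hk =>
    hB.mono fun ω hω => ⟨pow_nonneg (hω k hk).1 p, pow_le_pow_left₀ (hω k hk).1 (hω k hk).2 p⟩
  have iM4 : ∀ k, k ≤ n → Integrable (fun ω => M k ω ^ 4) μ := fun k hk =>
    integrable_of_ae_mem_Icc ((hMm' k hk).pow 4) (hpow 4 k hk)
  intro k
  induction k with
  | zero => intro _; simp
  | succ k ih =>
    intro hk
    have hk' : k ≤ n := by omega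
    have iD : Integrable (fun ω => M k ω ^ 3 * (M (k + 1) ω - M k ω)) μ :=
      ((iM (k + 1) hk).sub (iM k hk')).bdd_mul ((hMm' k hk').pow 3) (c := B ^ 3) <| by
        filter_upwards [hpow 3 k hk'] with ω hω
        rw [Real.norm_of_nonneg hω.1]
        exact hω.2
    have hD : ∫ ω, M k ω ^ 3 * (M (k + 1) ω - M k ω) ∂μ = 0 :=
      integral_mul_sub_eq_zero_of_condExp (ℱ.le k) (iM k hk') (iM (k + 1) hk)
        (hmart k hk) ((hM k hk').pow 3) (hpow 3 k hk')
    calc ∫ ω, M (k + 1) ω ^ 4 ∂μ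
        ≤ ∫ ω, ((1 + β) * M k ω ^ 4 + 4 * (M k ω ^ 3 * (M (k + 1) ω - M k ω))) ∂μ :=
          integral_mono_ae (iM4 (k + 1) hk) (((iM4 k hk').const_mul _).add (iD.const_mul _))
            (hstep.mono fun ω hω => hω k hk)
      _ = (1 + β) * ∫ ω, M k ω ^ 4 ∂μ := by
          rw [integral_add ((iM4 k hk').const_mul _) (iD.const_mul _), integral_const_mul,
            integral_const_mul, hD, mul_zero, add_zero]
      _ ≤ (1 + β) * ((1 + β) ^ k * ∫ ω, M 0 ω ^ 4 ∂μ) := by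
          gcongr
          exact ih hk'
      _ = (1 + β) ^ (k + 1) * ∫ ω, M 0 ω ^ 4 ∂μ := by ring

end

theorem exp_sub_one_le_mul_exp (a : ℝ) : Real.exp a - 1 ≤ a * Real.exp a := by
  have h := mul_le_mul_of_nonneg_left (Real.add_one_le_exp (-a)) (Real.exp_pos a).le
  rw [← Real.exp_add, add_neg_cancel, Real.exp_zero] at h
  linarith

theorem pow_four_le_of_mem_exp {a b r : ℝ} (ha : 0 ≤ a) (hab : a ≤ b)
    (hr : r ∈ ({Real.exp (-a), 1, Real.exp a} : Set ℝ)) :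
    0 ≤ r ∧ r ≤ Real.exp a ∧ r ^ 4 ≤ 1 + a ^ 2 * (6 * Real.exp b ^ 4) + 4 * (r - 1) := by
  have h1 : 1 ≤ Real.exp a := Real.one_le_exp ha
  have hE : Real.exp a ≤ Real.exp b := Real.exp_le_exp.2 hab
  have hae : a ≤ a * Real.exp a := le_mul_of_one_le_right ha h1
  have hu := exp_sub_one_le_mul_exp a
  have hn := Real.add_one_le_exp (-a)
  have hn1 : Real.exp (-a) ≤ 1 := Real.exp_le_one_iff.2 (by linarith)
  obtain ⟨h0, hle, hd⟩ : 0 ≤ r ∧ r ≤ Real.exp a ∧ |r - 1| ≤ a * Real.exp a := by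
    rcases hr with rfl | rfl | rfl
    · exact ⟨(Real.exp_pos _).le, hn1.trans h1, abs_le.2 ⟨by linarith, by linarith⟩⟩
    · exact ⟨zero_le_one, h1, by simpa using ha.trans hae⟩
    · exact ⟨(Real.exp_pos _).le, le_rfl, abs_le.2 ⟨by linarith, hu⟩⟩
  refine ⟨h0, hle, ?_⟩
  have hsq : (r - 1) ^ 2 ≤ (a * Real.exp b) ^ 2 := by
    refine sq_le_sq' ?_ ?_ <;>
      nlinarith [(abs_le.1 hd).1, (abs_le.1 hd).2, mul_le_mul_of_nonneg_left hE ha]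
  have hq : r ^ 2 + 2 * r + 3 ≤ 6 * Real.exp b ^ 2 := by nlinarith
  nlinarith [mul_le_mul hsq hq (by positivity) (by positivity)]

theorem le_mul_pow_of_div_le {x : ℕ → ℝ} {n : ℕ} {s R : ℝ} (hR : 0 ≤ R) (h0 : x 0 = s)
    (hpos : ∀ k, k ≤ n → 0 < x k) (hdiv : ∀ k, k < n → x (k + 1) / x k ≤ R) :
    ∀ k, k ≤ n → x k ≤ s * R ^ k
  | 0, _ => by simp [h0]
  | k + 1, hk => by
    have h := (div_le_iff₀ (hpos k (by omega))).1 (hdiv k hk)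
    calc x (k + 1) ≤ R * x k := h
      _ ≤ R * (s * R ^ k) :=
        mul_le_mul_of_nonneg_left (le_mul_pow_of_div_le hR h0 hpos hdiv k (by omega)) hR
      _ = s * R ^ (k + 1) := by ring

/-- For `σ̄, T > 0` there is a constant `C > 0` depending only on
`σ̄, T` such that for every `n ≥ 1`, every filtered probability space, every `s > 0`,
and every strictly positive martingale `(M_k)_{k=0}^n` with `M_0 = s` a.s. whose
one-step ratios lie in `{e^{−σ̄√(T/n)}, 1, e^{σ̄√(T/n)}}` a.s., one has
`E[max_{0 ≤ k ≤ n} M_k⁴] ≤ C·s⁴`. -/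
theorem stmt9 (σbar T : ℝ) (hσ : 0 < σbar) (hT : 0 < T) :
    ∃ C : ℝ, 0 < C ∧
      ∀ (n : ℕ), 0 < n →
      ∀ (Ω : Type) (mΩ : MeasurableSpace Ω) (μ : Measure Ω), IsProbabilityMeasure μ →
      ∀ (ℱ : Filtration ℕ mΩ) (s : ℝ), 0 < s →
      ∀ (M : ℕ → Ω → ℝ),
        (∀ k, k ≤ n → StronglyMeasurable[ℱ k] (M k)) →
        (∀ k, k ≤ n → Integrable (M k) μ) →
        (∀ k, k < n → μ[M (k + 1) | ℱ k] =ᵐ[μ] M k) →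
        (∀ᵐ ω ∂μ, ∀ k, k ≤ n → 0 < M k ω) →
        (∀ᵐ ω ∂μ, M 0 ω = s) →
        (∀ᵐ ω ∂μ, ∀ k, 1 ≤ k → k ≤ n →
          M k ω / M (k - 1) ω ∈
            ({Real.exp (-(σbar * Real.sqrt (T / n))), 1,
              Real.exp (σbar * Real.sqrt (T / n))} : Set ℝ)) →
        ∫ ω, ((Finset.range (n + 1)).sup' ⟨0, Finset.mem_range.mpr (Nat.succ_pos n)⟩
            fun k => (M k ω) ^ 4) ∂μ ≤ C * s ^ 4 := by
  set b : ℝ := σbar * Real.sqrt T with hb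
  set L : ℝ := σbar ^ 2 * T * (6 * Real.exp b ^ 4) with hL
  refine ⟨16 / 3 * Real.exp L, by positivity, ?_⟩
  intro n hn Ω mΩ μ hμ ℱ s hs M hM _ hmart hpos h0 hratio
  have hnR : (0 : ℝ) < n := Nat.cast_pos.2 hn
  set a : ℝ := σbar * Real.sqrt (T / n) with ha_def
  have ha : 0 ≤ a := by positivity
  have hab : a ≤ b := by
    have : (1 : ℝ) ≤ n := Nat.one_le_cast.2 hn
    exact mul_le_mul_of_nonneg_left (Real.sqrt_le_sqrt (div_le_self hT.le this)) hσ.le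
  have ha2 : a ^ 2 * (6 * Real.exp b ^ 4) = L / n := by
    rw [ha_def, mul_pow, Real.sq_sqrt (by positivity), hL]
    ring
  have hL0 : 0 ≤ L / n := by positivity
  have hstep : ∀ᵐ ω ∂μ, ∀ k, k < n →
      M (k + 1) ω / M k ω ≤ Real.exp a ∧
      M (k + 1) ω ^ 4 ≤
        (1 + L / n) * M k ω ^ 4 + 4 * (M k ω ^ 3 * (M (k + 1) ω - M k ω)) := by
    filter_upwards [hpos, hratio] with ω hp hr k hk
    obtain ⟨-, h1, h2⟩ := pow_four_le_of_mem_exp ha hab (hr (k + 1) (by omega) hk)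
    rw [Nat.add_sub_cancel] at h1 h2
    refine ⟨h1, ?_⟩
    have hx := hp k hk.le
    rw [ha2] at h2
    have h3 := mul_le_mul_of_nonneg_left h2 (pow_pos hx 4).le
    have e : M (k + 1) ω = M k ω * (M (k + 1) ω / M k ω) := by field_simp
    generalize M (k + 1) ω / M k ω = r at h3 e
    rw [e]
    linarith
  have hB : ∀ᵐ ω ∂μ, ∀ k, k ≤ n → 0 ≤ M k ω ∧ M k ω ≤ s * Real.exp a ^ n := by
    filter_upwards [hpos, h0, hstep] with ω hp h0 hd k hk
    refine ⟨(hp k hk).le, ?_⟩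
    refine (le_mul_pow_of_div_le (x := fun j => M j ω) (Real.exp_pos a).le h0 hp
      (fun j hj => (hd j hj).1) k hk).trans ?_
    exact mul_le_mul_of_nonneg_left (pow_le_pow_right₀ (Real.one_le_exp ha) hk) hs.le
  obtain ⟨iS, hDoob⟩ := integral_partialSups_pow_four_le hM hmart hB
  have hgeo := integral_pow_four_le_geometric hL0 hM hmart hB
    (hstep.mono fun ω hω k hk => (hω k hk).2) n le_rfl
  have hM0 : ∫ ω, M 0 ω ^ 4 ∂μ = s ^ 4 := by
    rw [integral_congr_ae (h0.mono fun ω hω => by simp only [hω] :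
      (fun ω => M 0 ω ^ 4) =ᵐ[μ] fun _ => s ^ 4)]
    simp
  have hexp : (1 + L / n) ^ n ≤ Real.exp L := by
    calc (1 + L / n) ^ n ≤ Real.exp (L / n) ^ n := by
          gcongr
          linarith [Real.add_one_le_exp (L / n)]
      _ = Real.exp L := by
          rw [← Real.exp_nat_mul]
          congr 1
          field_simp
  rw [hM0] at hgeo
  calc ∫ ω, ((Finset.range (n + 1)).sup' ⟨0, Finset.mem_range.mpr (Nat.succ_pos n)⟩
            fun k => (M k ω) ^ 4) ∂μ
      ≤ ∫ ω, partialSups (fun j => M j ω) n ^ 4 ∂μ := by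
        refine integral_mono_of_nonneg (Filter.Eventually.of_forall fun ω => ?_) iS ?_
        · exact (by positivity : (0 : ℝ) ≤ M 0 ω ^ 4).trans
            (Finset.le_sup' (fun k => M k ω ^ 4) (Finset.mem_range.mpr (Nat.succ_pos n)))
        · filter_upwards [hpos] with ω hp
          refine Finset.sup'_le _ _ fun k hk => ?_
          have hk : k ≤ n := Nat.lt_succ_iff.1 (Finset.mem_range.1 hk)
          exact pow_le_pow_left₀ (hp k hk).le (le_partialSups_of_le (fun j => M j ω) hk) 4
    _ ≤ 16 / 3 * ∫ ω, M n ω ^ 4 ∂μ := hDoob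
    _ ≤ 16 / 3 * (Real.exp L * s ^ 4) := by
        gcongr
        exact hgeo.trans (by gcongr)
    _ = 16 / 3 * Real.exp L * s ^ 4 := by ring
end

section
/- Let T > 0 and c > 0. There exists a constant C > 0 depending only on c and T such that the following holds for every positive integer n: if (Ω, F, (G_k)_{k=0}^n, P) is a filtered probability space and X_1, …, X_n are nonnegative integrable random variables with X_k measurable with respect to G_k, satisfying |E[X_k | G_{k−1}] − T/n| ≤ c·n^{−3/2} a.s. and E[X_k⁴ | G_{k−1}] ≤ c·n^{−4} a.s. for all k, then E[ max_{0 ≤ k ≤ n} | Σ_{i=1}^{k} X_i − k·T/n |⁴ ] ≤ C·n^{−2}. -/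
open MeasureTheory

theorem sub_pow_four_le (a b : ℝ) : (a - b) ^ 4 ≤ 8 * a ^ 4 + 8 * b ^ 4 := by
  nlinarith [sq_nonneg (a ^ 2 - b ^ 2),
    mul_nonneg (sq_nonneg (a + b)) (add_nonneg (sq_nonneg a) (sq_nonneg b)),
    mul_nonneg (sq_nonneg (a + b)) (sq_nonneg (a - b))]

section FourthMoments

variable {Ω : Type*} {mΩ : MeasurableSpace Ω} {μ : Measure Ω}

theorem MeasureTheory.MemLp.integrable_mul_mul_mul {f g h l : Ω → ℝ} (hf : MemLp f 4 μ)
    (hg : MemLp g 4 μ) (hh : MemLp h 4 μ) (hl : MemLp l 4 μ) :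
    Integrable (fun ω => f ω * g ω * h ω * l ω) μ := by
  have key : ∀ {u : Ω → ℝ}, MemLp u 4 μ → Integrable (fun ω => ‖u ω‖ ^ 4) μ := fun hu =>
    MemLp.integrable_norm_pow (p := 4) (by exact_mod_cast hu) (by norm_num)
  refine Integrable.mono' (((key hf).add (key hg)).add ((key hh).add (key hl)))
    (((hf.1.mul hg.1).mul hh.1).mul hl.1) (ae_of_all _ fun ω => ?_)
  simp only [norm_mul, Pi.add_apply]
  set a := ‖f ω‖
  set b := ‖g ω‖
  set c := ‖h ω‖
  set d := ‖l ω‖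
  nlinarith [sq_nonneg (a * b - c * d), sq_nonneg (a ^ 2 - b ^ 2), sq_nonneg (c ^ 2 - d ^ 2),
    sq_nonneg (a ^ 2), sq_nonneg (b ^ 2), sq_nonneg (c ^ 2), sq_nonneg (d ^ 2)]

theorem MeasureTheory.MemLp.integrable_pow_four {f : Ω → ℝ} (hf : MemLp f 4 μ) :
    Integrable (fun ω => f ω ^ 4) μ :=
  (hf.integrable_mul_mul_mul hf hf hf).congr (ae_of_all _ fun ω => by ring)

theorem MeasureTheory.memLp_four_of_integrable_pow {f : Ω → ℝ} (hf : AEStronglyMeasurable f μ)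
    (h : Integrable (fun ω => |f ω| ^ 4) μ) : MemLp f 4 μ := by
  rw [← integrable_norm_rpow_iff hf (by norm_num) (by norm_num)]
  refine h.congr (ae_of_all _ fun ω => ?_)
  have : (4 : ENNReal).toReal = (4 : ℕ) := by norm_num
  simp only [this, Real.rpow_natCast, Real.norm_eq_abs]

theorem MeasureTheory.memLp_partialSups_abs {p : ENNReal} {f : ℕ → Ω → ℝ}
    (hf : ∀ k, MemLp (f k) p μ) (n : ℕ) : MemLp (partialSups (fun k => |f k|) n) p μ := by
  induction n with
  | zero => rw [partialSups_zero]; exact (hf 0).abs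
  | succ n ih => rw [partialSups_add_one]; exact ih.sup (hf _).abs

variable [IsProbabilityMeasure μ] {ℱ : Filtration ℕ mΩ} {M : ℕ → Ω → ℝ}

theorem MeasureTheory.Martingale.integral_mul_increment_eq_zero (hM : Martingale M ℱ μ) (k : ℕ)
    {Z : Ω → ℝ} (hZ : StronglyMeasurable[ℱ k] Z)
    (hint : Integrable (fun ω => Z ω * (M (k + 1) ω - M k ω)) μ) :
    ∫ ω, Z ω * (M (k + 1) ω - M k ω) ∂μ = 0 := by
  have h1 : μ[M (k + 1) - M k | ℱ k] =ᵐ[μ] 0 := by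
    filter_upwards [condExp_sub (hM.integrable (k + 1)) (hM.integrable k) (ℱ k),
      hM.condExp_ae_eq (Nat.le_succ k), hM.condExp_ae_eq (le_refl k)] with ω h2 h3 h4
    simp only [Nat.succ_eq_add_one] at h3
    simp [h2, h3, h4]
  have h2 := condExp_mul_of_stronglyMeasurable_left (μ := μ) (g := M (k + 1) - M k) hZ hint
    ((hM.integrable (k + 1)).sub (hM.integrable k))
  change ∫ ω, (Z * (M (k + 1) - M k)) ω ∂μ = 0
  rw [← integral_condExp (ℱ.le k)]
  refine integral_eq_zero_of_ae ?_
  filter_upwards [h1, h2] with ω h3 h4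
  simp [h4, h3]

/-- Doob's maximal inequality in `L⁴`. -/
theorem MeasureTheory.Martingale.integral_partialSups_abs_pow_four_le (hM : Martingale M ℱ μ)
    (hL : ∀ k, MemLp (M k) 4 μ) (n : ℕ) :
    ∫ ω, (partialSups (fun k => |M k|) n ω) ^ 4 ∂μ ≤ 4 * ∫ ω, (M n ω) ^ 4 ∂μ := by
  set R : ℕ → Ω → ℝ := fun n => partialSups (fun k => |M k|) n with hR
  have hRs : ∀ k, R (k + 1) = R k ⊔ |M (k + 1)| := fun k => partialSups_add_one _ k
  have hR0 : R 0 = |M 0| := partialSups_zero _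
  have hRL : ∀ k, MemLp (R k) 4 μ := memLp_partialSups_abs hL
  have hRm : ∀ k, StronglyMeasurable[ℱ k] (R k) := by
    intro k
    induction k with
    | zero => rw [hR0]; exact (hM.stronglyMeasurable 0).norm
    | succ k ih =>
      rw [hRs]
      exact @StronglyMeasurable.sup _ _ _ _ (ℱ (k + 1)) _ _ _ (ih.mono (ℱ.mono (Nat.le_succ k)))
        (hM.stronglyMeasurable (k + 1)).norm
  have hRM : ∀ k, Integrable (fun ω => 2 * (R k ω * R k ω * M k ω * M k ω)) μ := fun k =>
    ((hRL k).integrable_mul_mul_mul (hRL k) (hL k) (hL k)).const_mul 2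
  have hΦ : ∀ k, Integrable (fun ω => 2 * (R k ω * R k ω * M k ω * M k ω) - R k ω ^ 4) μ :=
    fun k => (hRM k).sub (hRL k).integrable_pow_four
  have hpos : ∀ k, 0 ≤ ∫ ω, 2 * (R k ω * R k ω * M k ω * M k ω) - R k ω ^ 4 ∂μ := by
    intro k
    induction k with
    | zero =>
      refine integral_nonneg fun ω => ?_
      simp only [hR0, Pi.abs_apply, Pi.zero_apply]
      rw [Even.pow_abs (by decide), abs_mul_abs_self]
      nlinarith [sq_nonneg (M 0 ω ^ 2)]
    | succ k ih =>
      have hI : Integrable (fun ω => 4 * (R k ω * R k ω * M k ω) * (M (k + 1) ω - M k ω)) μ :=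
        (((hRL k).integrable_mul_mul_mul (hRL k) (hL k) ((hL (k + 1)).sub (hL k))).const_mul
          4).congr (ae_of_all _ fun ω => by simp only [Pi.sub_apply]; ring)
      have h0 := hM.integral_mul_increment_eq_zero k
        ((((hRm k).mul (hRm k)).mul (hM.stronglyMeasurable k)).const_mul 4) hI
      calc (0 : ℝ) ≤ ∫ ω, (2 * (R k ω * R k ω * M k ω * M k ω) - R k ω ^ 4)
            + 4 * (R k ω * R k ω * M k ω) * (M (k + 1) ω - M k ω) ∂μ := by
            rw [integral_add (hΦ k) hI]
            exact add_nonneg ih h0.ge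
        _ ≤ _ := by
            refine integral_mono ((hΦ k).add hI) (hΦ (k + 1)) fun ω => ?_
            simp only [hRs, Pi.sup_apply, Pi.abs_apply]
            set r := R k ω
            set m := M k ω
            set m' := M (k + 1) ω
            rcases le_total |m'| r with h | h
            · rw [sup_eq_left.2 h]
              nlinarith [sq_nonneg (r * (m' - m))]
            · rw [sup_eq_right.2 h, Even.pow_abs (by decide), abs_mul_abs_self]
              nlinarith [sq_nonneg (r * (m' - m)), sq_nonneg (m' ^ 2 - r ^ 2)]
  have h1 : ∫ ω, 2 * (R n ω * R n ω * M n ω * M n ω) - R n ω ^ 4 ∂μ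
      ≤ ∫ ω, 2 * M n ω ^ 4 - 1 / 2 * R n ω ^ 4 ∂μ := by
    refine integral_mono (hΦ n) (((hL n).integrable_pow_four.const_mul 2).sub
      ((hRL n).integrable_pow_four.const_mul (1 / 2))) fun ω => ?_
    dsimp only
    nlinarith [sq_nonneg (R n ω ^ 2 - 2 * M n ω ^ 2)]
  rw [integral_sub ((hL n).integrable_pow_four.const_mul 2)
      ((hRL n).integrable_pow_four.const_mul (1 / 2)), integral_const_mul, integral_const_mul] at h1
  have h2 := hpos n
  change ∫ ω, R n ω ^ 4 ∂μ ≤ _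
  linarith

theorem MeasureTheory.Martingale.integral_pow_four_add_one_le (hM : Martingale M ℱ μ)
    (hL : ∀ k, MemLp (M k) 4 μ) (k : ℕ) {t : ℝ} (ht : 0 < t) :
    ∫ ω, (M (k + 1) ω) ^ 4 ∂μ ≤ (1 + 4 / t) * ∫ ω, (M k ω) ^ 4 ∂μ
      + (4 * t + 3) * ∫ ω, (M (k + 1) ω - M k ω) ^ 4 ∂μ := by
  have hY : MemLp (fun ω => M (k + 1) ω - M k ω) 4 μ := (hL (k + 1)).sub (hL k)
  have hI : Integrable (fun ω => 4 * (M k ω * M k ω * M k ω) * (M (k + 1) ω - M k ω)) μ :=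
    (((hL k).integrable_mul_mul_mul (hL k) (hL k) hY).const_mul 4).congr
      (ae_of_all _ fun ω => by ring)
  have hm := hM.stronglyMeasurable k
  have h0 := hM.integral_mul_increment_eq_zero k (((hm.mul hm).mul hm).const_mul 4) hI
  have hI1 := (hL k).integrable_pow_four.const_mul (1 + 4 / t)
  have hI2 := hY.integrable_pow_four.const_mul (4 * t + 3)
  have hI12 : Integrable (fun ω => (1 + 4 / t) * M k ω ^ 4
      + (4 * t + 3) * (M (k + 1) ω - M k ω) ^ 4) μ := hI1.add hI2
  simp only [Pi.mul_apply] at h0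
  have h1 : ∫ ω, (M (k + 1) ω) ^ 4 ∂μ ≤ ∫ ω, ((1 + 4 / t) * M k ω ^ 4
      + (4 * t + 3) * (M (k + 1) ω - M k ω) ^ 4)
      + 4 * (M k ω * M k ω * M k ω) * (M (k + 1) ω - M k ω) ∂μ := by
    refine integral_mono (hL (k + 1)).integrable_pow_four (hI12.add hI) fun ω => ?_
    dsimp only
    obtain ⟨y, hy⟩ : ∃ y, y = M (k + 1) ω - M k ω := ⟨_, rfl⟩
    rw [show M (k + 1) ω = M k ω + y by linarith, add_sub_cancel_left]
    set m := M k ω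
    have h3 : 8 * (m ^ 2 * y ^ 2) ≤ 4 / t * m ^ 4 + 4 * t * y ^ 4 := by
      have : 4 / t * m ^ 4 + 4 * t * y ^ 4 - 8 * (m ^ 2 * y ^ 2)
          = 4 / t * (m ^ 2 - t * y ^ 2) ^ 2 := by
        field_simp
        ring
      have : 0 ≤ 4 / t * (m ^ 2 - t * y ^ 2) ^ 2 := by positivity
      linarith
    nlinarith [sq_nonneg (m * y - y ^ 2)]
  rw [integral_add hI12 hI, integral_add hI1 hI2, integral_const_mul, integral_const_mul]
    at h1
  linarith

theorem MeasureTheory.Martingale.integral_partialSups_abs_pow_four_le_of_increment_le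
    (hM : Martingale M ℱ μ) (hL : ∀ k, MemLp (M k) 4 μ) (h0 : M 0 = 0) {b : ℝ}
    (hb : ∀ k, ∫ ω, (M (k + 1) ω - M k ω) ^ 4 ∂μ ≤ b) {n : ℕ} (hn : 0 < n) :
    ∫ ω, (partialSups (fun k => |M k|) n ω) ^ 4 ∂μ ≤ 28 * Real.exp 4 * (n : ℝ) ^ 2 * b := by
  have hn1 : (1 : ℝ) ≤ n := by exact_mod_cast hn
  have hb0 : 0 ≤ b := (integral_nonneg fun ω => by positivity).trans (hb 0)
  have key : ∀ k : ℕ, ∫ ω, (M k ω) ^ 4 ∂μ ≤ k * (7 * n * b) * (1 + 4 / (n : ℝ)) ^ k := by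
    intro k
    induction k with
    | zero => simp [h0]
    | succ k ih =>
      have hone : (1 : ℝ) ≤ (1 + 4 / (n : ℝ)) ^ (k + 1) :=
        one_le_pow₀ (by linarith [show (0 : ℝ) ≤ 4 / n by positivity])
      calc ∫ ω, (M (k + 1) ω) ^ 4 ∂μ
          ≤ (1 + 4 / (n : ℝ)) * (k * (7 * n * b) * (1 + 4 / (n : ℝ)) ^ k)
            + (7 * n) * b * 1 := by
            refine (hM.integral_pow_four_add_one_le hL k (t := n) (by linarith)).trans ?_
            rw [mul_one]
            gcongr
            · linarith
            · exact hb k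
        _ ≤ (1 + 4 / (n : ℝ)) * (k * (7 * n * b) * (1 + 4 / (n : ℝ)) ^ k)
            + (7 * n) * b * (1 + 4 / (n : ℝ)) ^ (k + 1) := by gcongr
        _ = _ := by push_cast; ring
  have hexp : (1 + 4 / (n : ℝ)) ^ n ≤ Real.exp 4 := by
    calc (1 + 4 / (n : ℝ)) ^ n ≤ (Real.exp (4 / n)) ^ n := by
          gcongr
          linarith [Real.add_one_le_exp (4 / (n : ℝ))]
      _ = Real.exp 4 := by
          rw [← Real.exp_nat_mul]
          congr 1
          field_simp
  calc _ ≤ 4 * ∫ ω, (M n ω) ^ 4 ∂μ := hM.integral_partialSups_abs_pow_four_le hL n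
    _ ≤ 4 * (n * (7 * n * b) * Real.exp 4) := by
        gcongr
        exact (key n).trans (by gcongr)
    _ = _ := by ring

end FourthMoments

/-- For `T, c > 0` there is a constant `C > 0` depending only on
`c, T` such that: for every `n ≥ 1` and all nonnegative integrable adapted `X_k`
(`k = 1, …, n`) with `|E[X_k | G_{k−1}] − T/n| ≤ c·n^{−3/2}` a.s. and
`E[X_k⁴ | G_{k−1}] ≤ c·n^{−4}` a.s., one has
`E[max_{0 ≤ k ≤ n} |Σ_{i≤k} X_i − k·T/n|⁴] ≤ C·n^{−2}`. -/
theorem stmt11 (T c : ℝ) (hT : 0 < T) (hc : 0 < c) :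
    ∃ C : ℝ, 0 < C ∧
      ∀ (n : ℕ), 0 < n →
      ∀ (Ω : Type) (mΩ : MeasurableSpace Ω) (μ : Measure Ω), IsProbabilityMeasure μ →
      ∀ (ℱ : Filtration ℕ mΩ) (X : ℕ → Ω → ℝ),
        (∀ k, 1 ≤ k → k ≤ n → ∀ᵐ ω ∂μ, 0 ≤ X k ω) →
        (∀ k, 1 ≤ k → k ≤ n → Integrable (X k) μ) →
        (∀ k, 1 ≤ k → k ≤ n → StronglyMeasurable[ℱ k] (X k)) →
        (∀ k, 1 ≤ k → k ≤ n → ∀ᵐ ω ∂μ,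
          |(μ[X k | ℱ (k - 1)]) ω - T / n| ≤ c * (n : ℝ) ^ (-(3 : ℝ) / 2)) →
        (∀ k, 1 ≤ k → k ≤ n → ∀ᵐ ω ∂μ,
          (μ[fun ω' => (X k ω') ^ 4 | ℱ (k - 1)]) ω ≤ c * (n : ℝ) ^ (-(4 : ℝ))) →
        ∫ ω, ((Finset.range (n + 1)).sup' ⟨0, Finset.mem_range.mpr (Nat.succ_pos n)⟩
            fun k => |(∑ i ∈ Finset.Icc 1 k, X i ω) - (k : ℝ) * T / n| ^ 4) ∂μ
          ≤ C * (n : ℝ) ^ (-(2 : ℝ)) := by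
  refine ⟨8 * (28 * Real.exp 4 * (8 * (c + (T + c) ^ 4)) + c ^ 4), by positivity, ?_⟩
  intro n hn Ω mΩ μ hμ ℱ X _ hXi hXm hE h4
  have hn0 : (0 : ℝ) < n := by exact_mod_cast hn
  have hn1 : (1 : ℝ) ≤ n := by exact_mod_cast hn
  obtain ⟨s, hs⟩ : ∃ s : ℝ, s = (n : ℝ) ^ (-(1 : ℝ) / 2) := ⟨_, rfl⟩
  have hs0 : 0 ≤ s := hs ▸ by positivity
  have hs1 : s ≤ 1 := hs ▸ Real.rpow_le_one_of_one_le_of_nonpos hn1 (by norm_num)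
  have hs2 : s ^ 2 = (n : ℝ)⁻¹ := by
    rw [hs, ← Real.rpow_natCast, ← Real.rpow_mul hn0.le, ← Real.rpow_neg_one]
    norm_num
  have hr3 : (n : ℝ) ^ (-(3 : ℝ) / 2) = (n : ℝ)⁻¹ * s := by
    rw [hs, ← Real.rpow_neg_one, ← Real.rpow_add hn0]
    norm_num
  have hr4 : (n : ℝ) ^ (-(4 : ℝ)) = ((n : ℝ)⁻¹) ^ 4 := by
    rw [Real.rpow_neg hn0.le, inv_pow]
    norm_cast
  have hr2 : (n : ℝ) ^ (-(2 : ℝ)) = ((n : ℝ)⁻¹) ^ 2 := by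
    rw [Real.rpow_neg hn0.le, inv_pow]
    norm_cast
  rw [hr3] at hE
  rw [hr4] at h4
  rw [hr2]
  by_cases hF : Integrable (fun ω => (Finset.range (n + 1)).sup'
      ⟨0, Finset.mem_range.mpr (Nat.succ_pos n)⟩
      fun k => |(∑ i ∈ Finset.Icc 1 k, X i ω) - (k : ℝ) * T / n| ^ 4) μ
  swap
  · rw [integral_undef hF]
    positivity
  have hXL : ∀ k, 1 ≤ k → k ≤ n → MemLp (X k) 4 μ := by
    have hDL : ∀ k ≤ n, MemLp (fun ω => (∑ i ∈ Finset.Icc 1 k, X i ω) - (k : ℝ) * T / n) 4 μ := by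
      intro k hk
      have hm : AEStronglyMeasurable
          (fun ω => (∑ i ∈ Finset.Icc 1 k, X i ω) - (k : ℝ) * T / n) μ := by
        refine AEStronglyMeasurable.sub ?_ aestronglyMeasurable_const
        refine Finset.aestronglyMeasurable_fun_sum _ fun i hi => ?_
        rw [Finset.mem_Icc] at hi
        exact (hXi i hi.1 (hi.2.trans hk)).1
      refine memLp_four_of_integrable_pow hm (hF.mono' (hm.norm.pow 4) (ae_of_all _ fun ω => ?_))
      rw [Real.norm_of_nonneg (by positivity)]
      exact Finset.le_sup' (fun k : ℕ => |(∑ i ∈ Finset.Icc 1 k, X i ω) - (k : ℝ) * T / n| ^ 4)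
        (Finset.mem_range.2 (by omega))
    intro k hk1 hk
    obtain ⟨j, rfl⟩ := Nat.exists_eq_add_of_le' hk1
    convert ((hDL (j + 1) hk).sub (hDL j (by omega))).add (memLp_const (T / n)) using 1
    ext ω
    simp only [Pi.add_apply, Pi.sub_apply]
    rw [Finset.sum_Icc_succ_top (by omega)]
    push_cast
    ring
  let S : ℕ → Ω → ℝ := fun k => ∑ i ∈ Finset.Icc 1 (min k n), X i
  have hS0 : S 0 = 0 := by simp [S]
  have hSlt : ∀ i < n, S (i + 1) - S i = X (i + 1) := by
    intro i hi
    simp only [S]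
    rw [min_eq_left (by omega), min_eq_left (by omega), Finset.sum_Icc_succ_top (by omega),
      add_sub_cancel_left]
  have hSge : ∀ i, n ≤ i → S (i + 1) - S i = 0 := by
    intro i hi
    simp only [S]
    rw [min_eq_right (by omega), min_eq_right (by omega), sub_self]
  have hSL : ∀ k, MemLp (S k) 4 μ := fun k => memLp_finsetSum' _ fun i hi => by
    rw [Finset.mem_Icc] at hi
    exact hXL i hi.1 (by omega)
  have hSa : StronglyAdapted ℱ S := fun k => Finset.stronglyMeasurable_sum _ fun i hi => by
    rw [Finset.mem_Icc] at hi
    exact (hXm i hi.1 (by omega)).mono (ℱ.mono (by omega))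
  have hSi : ∀ k, Integrable (S k) μ := fun k => (hSL k).integrable (by norm_num)
  let M := martingalePart S ℱ μ
  have hM : Martingale M ℱ μ := martingale_martingalePart hSa hSi
  have hMP : ∀ k ω, S k ω = M k ω + predictablePart S ℱ μ k ω := fun k ω => by
    rw [← Pi.add_apply, ← Pi.add_apply, martingalePart_add_predictablePart]
  have hM0 : M 0 = 0 := by rw [← hS0]; exact martingalePart_zero
  have hPs : ∀ k, predictablePart S ℱ μ k = ∑ i ∈ Finset.range k, μ[S (i + 1) - S i | ℱ i] :=
    fun k => rfl
  have hPL : ∀ k, MemLp (predictablePart S ℱ μ k) 4 μ := fun k => by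
    rw [hPs]
    exact memLp_finsetSum' _ fun i _ => ((hSL _).sub (hSL _)).condExp (by norm_num)
  have hML : ∀ k, MemLp (M k) 4 μ := fun k => (hSL k).sub (hPL k)
  have hMinc : ∀ k ω, M (k + 1) ω - M k ω
      = (S (k + 1) - S k) ω - (μ[S (k + 1) - S k | ℱ k]) ω := by
    intro k ω
    have h1 := hMP (k + 1) ω
    have h2 := hMP k ω
    rw [hPs, Finset.sum_range_succ, ← hPs, Pi.add_apply] at h1
    rw [Pi.sub_apply]
    linarith
  have hb : ∀ k, ∫ ω, (M (k + 1) ω - M k ω) ^ 4 ∂μ ≤ 8 * (c + (T + c) ^ 4) * ((n : ℝ)⁻¹) ^ 4 := by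
    intro k
    simp only [hMinc]
    rcases lt_or_ge k n with hk | hk
    · rw [hSlt k hk]
      have hX := hXL (k + 1) (by omega) hk
      have hX4 : ∫ ω, X (k + 1) ω ^ 4 ∂μ ≤ c * ((n : ℝ)⁻¹) ^ 4 := by
        rw [← integral_condExp (ℱ.le k)]
        refine (integral_mono_ae integrable_condExp (integrable_const _)
          (h4 (k + 1) (by omega) hk)).trans ?_
        simp
      have hY : MemLp (fun ω => X (k + 1) ω - (μ[X (k + 1) | ℱ k]) ω) 4 μ :=
        hX.sub (hX.condExp (by norm_num))
      calc ∫ ω, (X (k + 1) ω - (μ[X (k + 1) | ℱ k]) ω) ^ 4 ∂μ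
          ≤ ∫ ω, 8 * X (k + 1) ω ^ 4 + 8 * ((T + c) * (n : ℝ)⁻¹) ^ 4 ∂μ := by
            refine integral_mono_ae hY.integrable_pow_four
              ((hX.integrable_pow_four.const_mul 8).add (integrable_const _)) ?_
            filter_upwards [hE (k + 1) (by omega) hk] with ω hω
            simp only [Nat.add_sub_cancel] at hω
            set x := X (k + 1) ω
            set e := (μ[X (k + 1) | ℱ k]) ω
            have he : |e| ≤ (T + c) * (n : ℝ)⁻¹ := by
              have h1 : |e| ≤ |e - T / n| + |T / n| := by
                simpa using abs_add_le (e - T / n) (T / n)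
              rw [abs_of_pos (show 0 < T / n by positivity), div_eq_mul_inv] at h1
              have h2 : c * ((n : ℝ)⁻¹ * s) ≤ c * ((n : ℝ)⁻¹ * 1) := by gcongr
              rw [div_eq_mul_inv] at hω
              linarith
            have h3 : e ^ 4 ≤ ((T + c) * (n : ℝ)⁻¹) ^ 4 := by
              rw [← Even.pow_abs (by decide) e]
              gcongr
            have h5 := sub_pow_four_le x e
            linarith
        _ ≤ _ := by
            rw [integral_add (hX.integrable_pow_four.const_mul 8) (integrable_const _),
              integral_const_mul, integral_const, probReal_univ, one_smul, mul_pow]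
            linarith
    · rw [hSge k hk, condExp_zero]
      simp only [Pi.zero_apply, sub_zero, ne_eq, OfNat.ofNat_ne_zero, not_false_eq_true, zero_pow,
        integral_zero]
      positivity
  have hmax := hM.integral_partialSups_abs_pow_four_le_of_increment_le hML hM0 hb hn
  have hRL : MemLp (partialSups (fun k => |M k|) n) 4 μ := memLp_partialSups_abs hML n
  have hbias : ∀ᵐ ω ∂μ, ∀ k ≤ n, |predictablePart S ℱ μ k ω - k * T / n| ≤ c * s := by
    have hE' : ∀ᵐ ω ∂μ, ∀ i < n, |(μ[X (i + 1) | ℱ i]) ω - T / n| ≤ c * ((n : ℝ)⁻¹ * s) := by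
      rw [ae_all_iff]
      intro i
      by_cases hi : i < n
      · filter_upwards [hE (i + 1) (by omega) hi] with ω hω _ using hω
      · exact ae_of_all _ fun ω h => absurd h hi
    filter_upwards [hE'] with ω hω k hk
    have h1 : predictablePart S ℱ μ k ω - k * T / n
        = ∑ i ∈ Finset.range k, ((μ[X (i + 1) | ℱ i]) ω - T / n) := by
      rw [Finset.sum_sub_distrib, hPs, Finset.sum_apply, Finset.sum_const, Finset.card_range,
        nsmul_eq_mul, mul_div_assoc]
      congr 1
      refine Finset.sum_congr rfl fun i hi => ?_
      rw [hSlt i (by rw [Finset.mem_range] at hi; omega)]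
    rw [h1]
    calc _ ≤ ∑ i ∈ Finset.range k, |(μ[X (i + 1) | ℱ i]) ω - T / n| :=
          Finset.abs_sum_le_sum_abs _ _
      _ ≤ ∑ i ∈ Finset.range k, c * ((n : ℝ)⁻¹ * s) := Finset.sum_le_sum fun i hi =>
          hω i (by rw [Finset.mem_range] at hi; omega)
      _ = k * (c * ((n : ℝ)⁻¹ * s)) := by simp
      _ ≤ n * (c * ((n : ℝ)⁻¹ * s)) := by gcongr
      _ = c * s := by field_simp
  have hR4 := hRL.integrable_pow_four.const_mul 8
  calc _ ≤ ∫ ω, 8 * partialSups (fun k => |M k|) n ω ^ 4 + 8 * (c * s) ^ 4 ∂μ := by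
        refine integral_mono_ae hF (hR4.add (integrable_const _)) ?_
        filter_upwards [hbias] with ω hω
        refine Finset.sup'_le _ _ fun k hk => ?_
        have hk : k ≤ n := by rw [Finset.mem_range] at hk; omega
        have h1 : (∑ i ∈ Finset.Icc 1 k, X i ω) - (k : ℝ) * T / n
            = M k ω - -(predictablePart S ℱ μ k ω - k * T / n) := by
          have h2 := hMP k ω
          simp only [S] at h2
          rw [min_eq_left hk, Finset.sum_apply] at h2
          rw [h2]
          ring
        have h3 : |M k ω| ≤ partialSups (fun k => |M k|) n ω :=
          le_partialSups_of_le (fun k => |M k|) hk ω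
        have h4 : M k ω ^ 4 ≤ partialSups (fun k => |M k|) n ω ^ 4 := by
          rw [← Even.pow_abs (by decide) (M k ω)]
          gcongr
        have h5 : (-(predictablePart S ℱ μ k ω - k * T / n)) ^ 4 ≤ (c * s) ^ 4 := by
          rw [← Even.pow_abs (by decide), abs_neg]
          gcongr
          exact hω k hk
        rw [h1, Even.pow_abs (by decide)]
        exact (sub_pow_four_le _ _).trans (by linarith)
    _ = 8 * ∫ ω, partialSups (fun k => |M k|) n ω ^ 4 ∂μ + 8 * (c * s) ^ 4 := by
        rw [integral_add hR4 (integrable_const _), integral_const_mul, integral_const,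
          probReal_univ, one_smul]
    _ ≤ 8 * (28 * Real.exp 4 * (n : ℝ) ^ 2 * (8 * (c + (T + c) ^ 4) * ((n : ℝ)⁻¹) ^ 4))
        + 8 * (c * s) ^ 4 := by gcongr
    _ = _ := by
        rw [mul_pow, show s ^ 4 = (s ^ 2) ^ 2 by ring, hs2]
        field_simp
end

section
/- Let θ ≥ 0, L > 0, and let w : [θ, ∞) → ℝ be a continuous function with w(θ) = 0. For A ∈ (0, L] define ρ_A := inf{ t ≥ θ : |w(t)| = A } ∈ [θ, ∞] (infimum of the empty set being ∞), and define κ_A ∈ [θ, ∞] by: κ_A := ∞ if ρ_A = ∞; κ_A := inf{ t ≥ ρ_A : w(t) = 0 or w(t) = L } if ρ_A < ∞ and w(ρ_A) = A; and κ_A := inf{ t ≥ ρ_A : w(t) = 0 or w(t) = −L } if ρ_A < ∞ and w(ρ_A) = −A. Then: (i) A₁ ≤ A₂ in (0, L] implies κ_{A₁} ≤ κ_{A₂}; and (ii) if A_m ↑ A in (0, L], then κ_{A_m} ↑ κ_A (in the extended reals [θ, ∞]). -/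
open scoped Classical

noncomputable section

/-- The first exit time `ρ_A := inf{ u ≥ θ : |w u| = A }` (as a real number; it is the
infimum of the - possibly empty - exit set). -/
def rhoTime (θ A : ℝ) (w : ℝ → ℝ) : ℝ :=
  sInf {u | θ ≤ u ∧ |w u| = A}

/-- The two-stage exit time `κ_A ∈ [θ, ∞]`: if `ρ_A = ∞` then `κ_A = ∞`; if
`w(ρ_A) = A` then `κ_A` is the first time after `ρ_A` at which `w` equals `0` or `L`;
if `w(ρ_A) = −A` then `κ_A` is the first time after `ρ_A` at which `w` equals `0` or
`−L` (the infimum of an empty set being `∞`). -/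
def kappaTime (θ L A : ℝ) (w : ℝ → ℝ) : EReal :=
  if ({u | θ ≤ u ∧ |w u| = A}).Nonempty then
    (if w (rhoTime θ A w) = A then
      (if ({u | rhoTime θ A w ≤ u ∧ (w u = 0 ∨ w u = L)}).Nonempty then
        ((sInf {u | rhoTime θ A w ≤ u ∧ (w u = 0 ∨ w u = L)} : ℝ) : EReal)
      else ⊤)
    else if w (rhoTime θ A w) = -A then
      (if ({u | rhoTime θ A w ≤ u ∧ (w u = 0 ∨ w u = -L)}).Nonempty then
        ((sInf {u | rhoTime θ A w ≤ u ∧ (w u = 0 ∨ w u = -L)} : ℝ) : EReal)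
      else ⊤)
    else ⊤)
  else ⊤

/-- `r` is the first time after `θ` at which `|w|` reaches the level `A`. -/
structure IsFirstExit (θ A : ℝ) (w : ℝ → ℝ) (r : ℝ) : Prop where
  start_le : θ ≤ r
  abs_eq : |w r| = A
  abs_lt : ∀ u, θ ≤ u → u < r → |w u| < A

lemma isClosed_setOf_le_and_mem {θ r : ℝ} {w : ℝ → ℝ} (hw : ContinuousOn w (Set.Ici θ))
    (hr : θ ≤ r) {s : Set ℝ} (hs : IsClosed s) : IsClosed {u | r ≤ u ∧ w u ∈ s} :=
  (hw.mono (Set.Ici_subset_Ici.2 hr)).preimage_isClosed_of_isClosed isClosed_Ici hs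

lemma exists_isFirstExit {θ A b : ℝ} {w : ℝ → ℝ} (hw : ContinuousOn w (Set.Ici θ))
    (hw0 : w θ = 0) (hA : 0 < A) (hb : θ ≤ b) (hAb : A ≤ |w b|) :
    ∃ r ≤ b, IsFirstExit θ A w r := by
  have hit : ∀ c, θ ≤ c → A ≤ |w c| → ∃ u, θ ≤ u ∧ u ≤ c ∧ |w u| = A := by
    intro c hc hAc
    obtain ⟨u, hu, hwu⟩ := intermediate_value_Icc hc
      ((hw.mono Set.Icc_subset_Ici_self).abs) ⟨by simpa [hw0] using hA.le, hAc⟩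
    exact ⟨u, hu.1, hu.2, hwu⟩
  obtain ⟨c, hc, hcb, hwc⟩ := hit b hb hAb
  have bdd : BddBelow {u | θ ≤ u ∧ |w u| = A} := ⟨θ, fun u hu => hu.1⟩
  have mem := (isClosed_setOf_le_and_mem hw le_rfl
    (isClosed_eq continuous_abs continuous_const : IsClosed {x : ℝ | |x| = A})).csInf_mem
      ⟨c, hc, hwc⟩ bdd
  refine ⟨_, (csInf_le bdd ⟨hc, hwc⟩).trans hcb, mem.1, mem.2, fun u hu hur => ?_⟩
  by_contra! h
  obtain ⟨v, hv, hvu, hwv⟩ := hit u hu h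
  exact (hvu.trans_lt hur).not_ge (csInf_le bdd ⟨hv, hwv⟩)

namespace IsFirstExit

variable {θ A r : ℝ} {w : ℝ → ℝ}

lemma rhoTime_eq (h : IsFirstExit θ A w r) : rhoTime θ A w = r := by
  refine IsLeast.csInf_eq ⟨⟨h.start_le, h.abs_eq⟩, fun u hu => ?_⟩
  by_contra! hur
  exact (h.abs_lt u hu.1 hur).ne hu.2

lemma le_of_level_le {B s : ℝ} (h : IsFirstExit θ A w r) (h' : IsFirstExit θ B w s)
    (hAB : A ≤ B) : r ≤ s := by
  by_contra! hsr
  exact ((h.abs_lt s h'.start_le hsr).trans_le hAB).ne h'.abs_eq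

lemma eq_or_eq_neg (h : IsFirstExit θ A w r) : w r = A ∨ w r = -A :=
  eq_or_eq_neg_of_abs_eq h.abs_eq

/-- Given the first exit time `r`, `κ_A` is the first time after `r` at which `w` vanishes or
reaches the outer level on the side of `w r`. -/
lemma kappaTime_eq (h : IsFirstExit θ A w r) (hA : 0 < A) (L : ℝ) :
    kappaTime θ L A w =
      if {u | r ≤ u ∧ (w u = 0 ∨ A * w u = L * w r)}.Nonempty then
        ((sInf {u | r ≤ u ∧ (w u = 0 ∨ A * w u = L * w r)} : ℝ) : EReal) else ⊤ := by
  have ne : {u | θ ≤ u ∧ |w u| = A}.Nonempty := ⟨r, h.start_le, h.abs_eq⟩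
  unfold kappaTime
  rw [if_pos ne, h.rhoTime_eq]
  rcases h.eq_or_eq_neg with e | e
  · have (u : ℝ) : A * w u = L * A ↔ w u = L := by
      rw [mul_comm L, mul_right_inj' hA.ne']
    simp only [e, if_true, this]
  · have (u : ℝ) : A * w u = L * -A ↔ w u = -L := by
      rw [mul_neg, ← neg_mul, mul_comm (-L), mul_right_inj' hA.ne']
    have hne : -A ≠ A := by linarith
    simp only [e, if_true, this, if_neg hne]

end IsFirstExit

lemma kappaTime_le_coe_iff {θ L A : ℝ} {w : ℝ → ℝ} (hw : ContinuousOn w (Set.Ici θ))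
    (hw0 : w θ = 0) (hA : 0 < A) (t : ℝ) :
    kappaTime θ L A w ≤ t ↔
      ∃ r s, IsFirstExit θ A w r ∧ r ≤ s ∧ s ≤ t ∧ (w s = 0 ∨ A * w s = L * w r) := by
  constructor
  · intro h
    by_cases ne : {u | θ ≤ u ∧ |w u| = A}.Nonempty
    · obtain ⟨b, hb, hwb⟩ := ne
      obtain ⟨r, -, hr⟩ := exists_isFirstExit hw hw0 hA hb hwb.ge
      rw [hr.kappaTime_eq hA] at h
      split_ifs at h with hT
      · have mem := (isClosed_setOf_le_and_mem hw hr.start_le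
          ((isClosed_eq continuous_id continuous_const).union
            (isClosed_eq (continuous_const.mul continuous_id) continuous_const) :
            IsClosed {x : ℝ | x = 0 ∨ A * x = L * w r})).csInf_mem hT ⟨r, fun u hu => hu.1⟩
        exact ⟨r, _, hr, mem.1, EReal.coe_le_coe_iff.1 h, mem.2⟩
      · simp at h
    · simp [kappaTime, if_neg ne] at h
  · rintro ⟨r, s, hr, hrs, hst, hs⟩
    have ne : {u | r ≤ u ∧ (w u = 0 ∨ A * w u = L * w r)}.Nonempty := ⟨s, hrs, hs⟩
    rw [hr.kappaTime_eq hA, if_pos ne, EReal.coe_le_coe_iff]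
    exact csInf_le_of_le ⟨r, fun u hu => hu.1⟩ ⟨hrs, hs⟩ hst

lemma kappaTime_mono {θ L A₁ A₂ : ℝ} {w : ℝ → ℝ} (hw : ContinuousOn w (Set.Ici θ))
    (hw0 : w θ = 0) (hA₁ : 0 < A₁) (h : A₁ ≤ A₂) :
    kappaTime θ L A₁ w ≤ kappaTime θ L A₂ w := by
  have hA₂ := hA₁.trans_le h
  refine EReal.le_of_forall_lt_iff_le.1 fun t ht => ?_
  obtain ⟨r₂, s, hr₂, hrs, hst, hs⟩ := (kappaTime_le_coe_iff hw hw0 hA₂ t).1 ht.le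
  obtain ⟨r₁, hr, hr₁⟩ := exists_isFirstExit hw hw0 hA₁ hr₂.start_le (h.trans hr₂.abs_eq.ge)
  refine (kappaTime_le_coe_iff hw hw0 hA₁ t).2 ?_
  by_cases same : A₁ * w r₂ = A₂ * w r₁
  · refine ⟨r₁, s, hr₁, hr.trans hrs, hst, hs.imp_right fun hs => ?_⟩
    refine mul_left_cancel₀ hA₂.ne' ?_
    linear_combination A₁ * hs + L * same
  · have hc : ContinuousOn w (Set.uIcc r₁ r₂) := by
      rw [Set.uIcc_of_le hr]
      exact hw.mono fun u hu => hr₁.start_le.trans hu.1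
    have zero_mem : (0 : ℝ) ∈ Set.uIcc (w r₁) (w r₂) := by
      rw [Set.mem_uIcc]
      rcases hr₁.eq_or_eq_neg with e₁ | e₁ <;> rcases hr₂.eq_or_eq_neg with e₂ | e₂ <;>
        rw [e₁, e₂] at same ⊢
      · exact absurd (mul_comm _ _) same
      · right; constructor <;> linarith
      · left; constructor <;> linarith
      · exact absurd (by ring) same
    obtain ⟨v, hv, hwv⟩ := intermediate_value_uIcc hc zero_mem
    rw [Set.uIcc_of_le hr] at hv
    exact ⟨r₁, v, hr₁, hv.1, hv.2.trans (hrs.trans hst), Or.inl hwv⟩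

/-- A bound on `κ` along levels increasing to `A` is a bound on `κ_A`. -/
lemma kappaTime_le_of_tendsto {θ L A t : ℝ} {w : ℝ → ℝ} {Am : ℕ → ℝ}
    (hw : ContinuousOn w (Set.Ici θ)) (hw0 : w θ = 0) (hA : A ∈ Set.Ioc 0 L)
    (hAm : ∀ m, 0 < Am m) (mono : Monotone Am) (lim : Filter.Tendsto Am Filter.atTop (nhds A))
    (ht : ∀ m, kappaTime θ L (Am m) w ≤ t) : kappaTime θ L A w ≤ t := by
  choose r s hr hrs hst hs using fun m => (kappaTime_le_coe_iff hw hw0 (hAm m) t).1 (ht m)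
  have r_mono : Monotone r := fun m k hmk => (hr m).le_of_level_le (hr k) (mono hmk)
  have bdd : BddAbove (Set.range r) := ⟨t, by rintro _ ⟨m, rfl⟩; exact (hrs m).trans (hst m)⟩
  have r_lim := tendsto_atTop_ciSup r_mono bdd
  have r_le := le_ciSup bdd
  set ρ := ⨆ m, r m
  have hθρ : θ ≤ ρ := (hr 0).start_le.trans (r_le 0)
  have w_lim : Filter.Tendsto (fun m => w (r m)) Filter.atTop (nhds (w ρ)) :=
    (hw ρ hθρ).tendsto.comp
      (tendsto_nhdsWithin_iff.2 ⟨r_lim, Filter.Eventually.of_forall fun m => (hr m).start_le⟩)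
  have hρ : IsFirstExit θ A w ρ := by
    refine ⟨hθρ, tendsto_nhds_unique w_lim.abs (by simpa only [(hr _).abs_eq] using lim), ?_⟩
    intro u hu huρ
    obtain ⟨m, hm⟩ := exists_lt_of_lt_ciSup huρ
    exact ((hr m).abs_lt u hu hm).trans_le (mono.ge_of_tendsto lim m)
  obtain ⟨δ, hδ, near⟩ := Metric.continuousWithinAt_iff.1 (hw ρ hθρ) A hA.1
  obtain ⟨m, hm : dist (r m) ρ < δ⟩ :=
    (r_lim.eventually (Metric.ball_mem_nhds ρ hδ)).exists
  have close : ∀ u, r m ≤ u → u ≤ ρ → |w u - w ρ| < A := by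
    intro u hu huρ
    refine near ((hr m).start_le.trans hu) ?_
    rw [Real.dist_eq, abs_lt] at hm
    rw [Real.dist_eq, abs_lt]
    constructor <;> linarith
  have same : Am m * w ρ = A * w (r m) := by
    have hc := abs_lt.1 (close (r m) le_rfl (r_le m))
    have pos := hAm m
    rcases (hr m).eq_or_eq_neg with e₁ | e₁ <;> rcases hρ.eq_or_eq_neg with e₂ | e₂ <;>
      rw [e₁, e₂] at hc ⊢
    · ring
    · linarith
    · linarith
    · ring
  have hρs : ρ ≤ s m := by
    by_contra! hlt
    rcases hs m with h0 | h1
    · have := close (s m) (hrs m) hlt.le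
      rw [h0, zero_sub, abs_neg, hρ.abs_eq] at this
      exact this.false
    · have hlt' := hρ.abs_lt (s m) ((hr m).start_le.trans (hrs m)) hlt
      have habs := congrArg abs h1
      rw [abs_mul, abs_mul, (hr m).abs_eq, abs_of_pos (hAm m), abs_of_pos (hA.1.trans_le hA.2),
        mul_comm L, mul_right_inj' (hAm m).ne'] at habs
      linarith [hA.2]
  refine (kappaTime_le_coe_iff hw hw0 hA.1 t).2
    ⟨ρ, s m, hρ, hρs, hst m, (hs m).imp_right fun h => ?_⟩
  refine mul_left_cancel₀ (hAm m).ne' ?_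
  linear_combination A * h - L * same

/-- For `θ ≥ 0`, `L > 0` and a continuous path `w` on `[θ, ∞)` with
`w θ = 0`, the two-stage exit times `κ_A` are (i) monotone in the level `A ∈ (0, L]`,
and (ii) left-continuous along nondecreasing sequences `A_m ↑ A` in `(0, L]`:
`κ_{A_m} ↑ κ_A` in the extended reals. -/
theorem stmt14 (θ L : ℝ) (hθ : 0 ≤ θ) (hL : 0 < L)
    (w : ℝ → ℝ) (hw : ContinuousOn w (Set.Ici θ)) (hw0 : w θ = 0) :
    (∀ A₁ A₂ : ℝ, A₁ ∈ Set.Ioc 0 L → A₂ ∈ Set.Ioc 0 L → A₁ ≤ A₂ →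
      kappaTime θ L A₁ w ≤ kappaTime θ L A₂ w) ∧
    (∀ (A : ℝ) (Am : ℕ → ℝ), A ∈ Set.Ioc 0 L → (∀ m, Am m ∈ Set.Ioc 0 L) →
      Monotone Am → Filter.Tendsto Am Filter.atTop (nhds A) →
      Monotone (fun m => kappaTime θ L (Am m) w) ∧
        Filter.Tendsto (fun m => kappaTime θ L (Am m) w) Filter.atTop
          (nhds (kappaTime θ L A w))) := by
  refine ⟨fun A₁ A₂ h₁ _ h => kappaTime_mono hw hw0 h₁.1 h, fun A Am hA hAm mono lim => ?_⟩
  have κ_mono : Monotone (fun m => kappaTime θ L (Am m) w) :=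
    fun m k hmk => kappaTime_mono hw hw0 (hAm m).1 (mono hmk)
  refine ⟨κ_mono, tendsto_order.2 ⟨fun a ha => ?_, fun b hb => ?_⟩⟩
  · obtain ⟨t, hat, ht⟩ := EReal.lt_iff_exists_real_btwn.1 ha
    have : ∃ m, (t : EReal) < kappaTime θ L (Am m) w := by
      by_contra! h
      exact ht.not_ge (kappaTime_le_of_tendsto hw hw0 hA (fun m => (hAm m).1) mono lim h)
    obtain ⟨m, hm⟩ := this
    filter_upwards [Filter.eventually_ge_atTop m] with k hk
    exact hat.trans (hm.trans_le (κ_mono hk))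
  · exact Filter.Eventually.of_forall fun m =>
      (kappaTime_mono hw hw0 (hAm m).1 (mono.ge_of_tendsto lim m)).trans_lt hb

end
end
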